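/- For ν ∈ ℝ, the operator l_ν = d²/dr² − (ν² − 1/4)/r², with domain C_c^∞(ℝ₊) in L²(ℝ₊, dr) (Lebesgue measure on (0, ∞)), is essentially selfadjoint if and only if |ν| ≥ 1. -/

import Mathlib

open MeasureTheory Set

/-- The Lebesgue measure on `ℝ₊ = (0, ∞)`, so that
`Lp ℂ 2 halfLineMeasure = L²(ℝ₊, dr)`. -/
noncomputable def halfLineMeasure : Measure ℝ := volume.restrict (Set.Ioi (0:ℝ))

/-- `C_c^∞(ℝ₊)`: smooth functions compactly supported in `(0, ∞)`. -/
def IsHalfLineTest (f : ℝ → ℂ) : Prop :=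
  ContDiff ℝ (⊤ : ℕ∞) f ∧ HasCompactSupport f ∧ tsupport f ⊆ Set.Ioi (0:ℝ)

/-- The Bessel operator `l_ν f = f″ − ((ν² − 1/4)/r²) f`. -/
noncomputable def besselOp (ν : ℝ) (f : ℝ → ℂ) (r : ℝ) : ℂ :=
  deriv (deriv f) r - (((ν ^ 2 - 1 / 4) / r ^ 2 : ℝ) : ℂ) * f r

open scoped LinearPMap InnerProductSpace

section Abstract

variable {E : Type*} [NormedAddCommGroup E] [InnerProductSpace ℂ E] [CompleteSpace E]
  {T : E →ₗ.[ℂ] E}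

/-- A densely defined symmetric operator is closable. -/
theorem LinearPMap.IsFormalAdjoint.isClosable (hT : Dense (T.domain : Set E))
    (hs : T.IsFormalAdjoint T) : T.IsClosable :=
  (LinearPMap.adjoint_isClosed hT).isClosable.leIsClosable (hs.le_adjoint hT)

theorem LinearPMap.IsFormalAdjoint.closure_le_adjoint (hT : Dense (T.domain : Set E))
    (hs : T.IsFormalAdjoint T) : T.closure ≤ T† := by
  have h := (LinearPMap.adjoint_isClosed hT).isClosable.closure_mono (hs.le_adjoint hT)
  have hc : T†.closure = T† := by
    apply LinearPMap.eq_of_eq_graph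
    rw [← (LinearPMap.adjoint_isClosed hT).isClosable.graph_closure_eq_closure_graph]
    exact (LinearPMap.adjoint_isClosed hT).submodule_topologicalClosure_eq
  rwa [hc] at h

/-- If the closure of a densely defined symmetric operator is its adjoint, the adjoint is
symmetric. -/
theorem LinearPMap.IsFormalAdjoint.adjoint_of_adjoint_eq_closure (hT : Dense (T.domain : Set E))
    (hs : T.IsFormalAdjoint T) (h : T† = T.closure) : T†.IsFormalAdjoint T† := by
  intro x y
  have hcl : _root_.IsClosed {p : E × E | ⟪p.2, (y : E)⟫_ℂ = ⟪p.1, T† y⟫_ℂ} :=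
    isClosed_eq (by fun_prop) (by fun_prop)
  have hsub : (T.graph : Set (E × E)) ⊆ {p : E × E | ⟪p.2, (y : E)⟫_ℂ = ⟪p.1, T† y⟫_ℂ} := by
    rintro p hp
    obtain ⟨z, hz1, hz2⟩ := (LinearPMap.mem_graph_iff _).1 hp
    change ⟪p.2, (y : E)⟫_ℂ = ⟪p.1, T† y⟫_ℂ
    rw [← hz1, ← hz2]
    exact (LinearPMap.adjoint_isFormalAdjoint hT).symm z y
  have hx : ((x : E), T† x) ∈ T.graph.topologicalClosure := by
    rw [(hs.isClosable hT).graph_closure_eq_closure_graph, ← h]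
    exact LinearPMap.mem_graph _ x
  exact closure_minimal hsub hcl hx

/-- Von Neumann's criterion: a densely defined symmetric operator whose deficiency spaces are
trivial is essentially selfadjoint. -/
theorem LinearPMap.IsFormalAdjoint.adjoint_eq_closure (hT : Dense (T.domain : Set E))
    (hs : T.IsFormalAdjoint T)
    (hp : ∀ x : T†.domain, T† x = Complex.I • (x : E) → (x : E) = 0)
    (hm : ∀ x : T†.domain, T† x = (-Complex.I) • (x : E) → (x : E) = 0) :
    T† = T.closure := by
  have hcl := hs.closure_le_adjoint hT
  refine le_antisymm (LinearPMap.le_of_le_graph ?_) hcl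
  set K : Submodule ℂ (WithLp 2 (E × E)) :=
    T.closure.graph.comap (WithLp.linearEquiv 2 ℂ (E × E)).toLinearMap with hK
  have hKc : _root_.IsClosed (K : Set (WithLp 2 (E × E))) :=
    (hs.isClosable hT).closure_isClosed.preimage (WithLp.prod_continuous_ofLp 2 E E)
  have : CompleteSpace K := hKc.completeSpace_coe
  rintro p hpT
  set P : WithLp 2 (E × E) := WithLp.toLp 2 p
  obtain ⟨a, ha, b, hb, hab⟩ := K.exists_add_mem_mem_orthogonal P
  have haT : a.ofLp ∈ T†.graph := LinearPMap.le_graph_of_le hcl ha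
  have hbT : b.ofLp ∈ T†.graph := by
    have : b.ofLp = p - a.ofLp := by
      have : p = (a + b).ofLp := by rw [← hab]
      simp [this]
    rw [this]; exact Submodule.sub_mem _ hpT haT
  obtain ⟨f, hf1, hf2⟩ := (LinearPMap.mem_graph_iff _).1 hbT
  have hz : ∀ z : T.domain, ⟪-(f : E), (z : E)⟫_ℂ = ⟪T† f, T z⟫_ℂ := by
    intro z
    have hzK : WithLp.toLp 2 ((z : E), T z) ∈ K :=
      LinearPMap.le_graph_of_le T.le_closure (LinearPMap.mem_graph T z)
    have := (Submodule.mem_orthogonal' _ _).1 hb _ hzK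
    simp only [WithLp.prod_inner_apply] at this
    rw [hf1, hf2, inner_neg_left, neg_eq_iff_add_eq_zero]
    exact this
  have hdom : T† f ∈ T†.domain := LinearPMap.mem_adjoint_domain_of_exists _ ⟨_, hz⟩
  have hTT : T† ⟨T† f, hdom⟩ = -(f : E) := LinearPMap.adjoint_apply_eq hT _ hz
  have h1 : T† f - Complex.I • (f : E) = 0 := by
    refine hm (⟨T† f, hdom⟩ - Complex.I • f) ?_
    rw [LinearPMap.map_sub, LinearPMap.map_smul, hTT]
    simp [smul_sub, smul_smul]
    abel
  have h2 : (f : E) = 0 := hp f (sub_eq_zero.1 h1)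
  have h3 : b = 0 := by
    have h4 : T† f = 0 := by rw [sub_eq_zero.1 h1, h2, smul_zero]
    have : b.ofLp = 0 := Prod.ext (hf1.symm.trans h2) (hf2.symm.trans h4)
    exact (WithLp.ofLp_injective 2) this
  rw [h3, add_zero] at hab
  have : p = a.ofLp := by rw [← hab]
  rw [this]; exact ha

end Abstract

namespace IsHalfLineTest

variable {f g w h h' : ℝ → ℂ}

theorem differentiable (hf : IsHalfLineTest f) : Differentiable ℝ f :=
  hf.1.differentiable (by simp)

theorem hasDerivAt (hf : IsHalfLineTest f) (x : ℝ) : HasDerivAt f (deriv f x) x :=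
  (hf.differentiable x).hasDerivAt

theorem continuous (hf : IsHalfLineTest f) : Continuous f := hf.1.continuous

theorem deriv (hf : IsHalfLineTest f) : IsHalfLineTest (deriv f) :=
  ⟨(contDiff_infty_iff_deriv.1 hf.1).2, hf.2.1.deriv,
    (tsupport_deriv_subset (f := f)).trans hf.2.2⟩

theorem sub (hf : IsHalfLineTest f) (hg : IsHalfLineTest g) :
    IsHalfLineTest (fun x => f x - g x) :=
  ⟨hf.1.sub hg.1, hf.2.1.sub hg.2.1, (tsupport_sub f g).trans (union_subset hf.2.2 hg.2.2)⟩

theorem const_mul (c : ℂ) (hf : IsHalfLineTest f) : IsHalfLineTest (fun x => c * f x) :=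
  ⟨contDiff_const.mul hf.1, hf.2.1.mul_left,
    (tsupport_mul_subset_right (f := fun _ : ℝ => c) (g := f)).trans hf.2.2⟩

theorem star (hf : IsHalfLineTest f) : IsHalfLineTest (fun x => (starRingEnd ℂ) (f x)) := by
  have hs : tsupport (fun x => (starRingEnd ℂ) (f x)) ⊆ tsupport f :=
    closure_mono fun x hx hfx => hx (by simp [hfx])
  exact ⟨Complex.conjCLE.contDiff.comp hf.1, hf.2.1.comp_left (map_zero _), hs.trans hf.2.2⟩

theorem eq_zero_of_nonpos (hf : IsHalfLineTest f) {x : ℝ} (hx : x ≤ 0) : f x = 0 :=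
  image_eq_zero_of_notMem_tsupport fun hm => (not_lt.2 hx) (hf.2.2 hm)

theorem exists_Icc (hf : IsHalfLineTest f) :
    ∃ a b : ℝ, 0 < a ∧ a < 1 ∧ 1 < b ∧ tsupport f ⊆ Ioo a b := by
  rcases (tsupport f).eq_empty_or_nonempty with he | hne
  · refine ⟨1 / 2, 2, by norm_num, by norm_num, by norm_num, fun x hx => ?_⟩
    exact absurd hx (by simp [he])
  · obtain ⟨a, ha, hamin⟩ := hf.2.1.isCompact.exists_isLeast hne
    obtain ⟨b, hb, hbmax⟩ := hf.2.1.isCompact.exists_isGreatest hne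
    have ha0 : 0 < a := hf.2.2 ha
    refine ⟨min a 1 / 2, max b 1 + 1, by positivity, ?_, ?_, fun x hx => ⟨?_, ?_⟩⟩
    · linarith [min_le_right a 1]
    · linarith [le_max_right b 1]
    · have := hamin hx
      have h2 : 0 < min a 1 := by positivity
      linarith [min_le_left a 1]
    · have := hbmax hx
      linarith [le_max_left b 1]

theorem integrable (hf : IsHalfLineTest f) : Integrable f :=
  hf.continuous.integrable_of_hasCompactSupport hf.2.1

theorem integrable_mul (hf : IsHalfLineTest f) (hw : LocallyIntegrableOn w (Ioi 0)) :
    Integrable (fun x => f x * w x) := by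
  have h1 : IntegrableOn (fun x => f x * w x) (tsupport f) :=
    (hw.integrableOn_compact_subset hf.2.2 hf.2.1).continuousOn_mul
      hf.continuous.continuousOn hf.2.1
  refine (integrableOn_iff_integrable_of_support_subset fun x hx => ?_).1 h1
  exact subset_tsupport f fun hfx => hx (by simp [hfx])

theorem setIntegral_mul (hf : IsHalfLineTest f) (w : ℝ → ℂ) :
    ∫ x in Ioi 0, f x * w x = ∫ x, f x * w x :=
  setIntegral_eq_integral_of_forall_compl_eq_zero fun x hx => by
    rw [hf.eq_zero_of_nonpos (not_lt.1 hx), zero_mul]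

/-- Integration by parts against a test function. -/
theorem integral_deriv_mul (hf : IsHalfLineTest f)
    (hh : ∀ x, 0 < x → HasDerivAt h (h' x) x) (hh' : LocallyIntegrableOn h' (Ioi 0)) :
    ∫ x, _root_.deriv f x * h x = -∫ x, f x * h' x := by
  have hc : LocallyIntegrableOn h (Ioi 0) :=
    ContinuousOn.locallyIntegrableOn (fun x hx => (hh x hx).continuousAt.continuousWithinAt)
      measurableSet_Ioi
  have hd : ∀ x, HasDerivAt (fun x => f x * h x) (_root_.deriv f x * h x + f x * h' x) x := by
    intro x
    by_cases hx : x ∈ tsupport f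
    · exact (hf.hasDerivAt x).mul (hh x (hf.2.2 hx))
    · have h0 : f =ᶠ[nhds x] 0 := notMem_tsupport_iff_eventuallyEq.1 hx
      have h1 : (fun x => f x * h x) =ᶠ[nhds x] fun _ => 0 := by
        filter_upwards [h0] with y hy
        simp [hy]
      have h2 : _root_.deriv f x = 0 := by
        rw [h0.deriv_eq]; simp
      rw [h2, h0.eq_of_nhds]
      simpa using (hasDerivAt_const x (0 : ℂ)).congr_of_eventuallyEq h1
  have hi1 := hf.deriv.integrable_mul hc
  have hi2 := hf.integrable_mul hh'
  have := integral_eq_zero_of_hasDerivAt_of_integrable hd (hi1.add hi2) (hf.integrable_mul hc)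
  rw [integral_add hi1 hi2] at this
  exact eq_neg_of_add_eq_zero_left this

theorem integral_deriv_deriv_mul (hf : IsHalfLineTest f) {h'' : ℝ → ℂ}
    (hh : ∀ x, 0 < x → HasDerivAt h (h' x) x) (hh' : ∀ x, 0 < x → HasDerivAt h' (h'' x) x)
    (hh'' : LocallyIntegrableOn h'' (Ioi 0)) :
    ∫ x, _root_.deriv (_root_.deriv f) x * h x = ∫ x, f x * h'' x := by
  have hc : LocallyIntegrableOn h' (Ioi 0) :=
    ContinuousOn.locallyIntegrableOn (fun x hx => (hh' x hx).continuousAt.continuousWithinAt)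
      measurableSet_Ioi
  rw [hf.deriv.integral_deriv_mul hh hc, hf.integral_deriv_mul hh' hh'', neg_neg]

theorem integral_deriv (hf : IsHalfLineTest f) : ∫ x, _root_.deriv f x = 0 :=
  integral_eq_zero_of_hasDerivAt_of_integrable hf.hasDerivAt hf.deriv.integrable hf.integrable

/-- A test function with vanishing integral is the derivative of a test function. -/
theorem exists_primitive (hf : IsHalfLineTest f) (h0 : ∫ x, f x = 0) :
    ∃ F, IsHalfLineTest F ∧ _root_.deriv F = f := by
  obtain ⟨a, b, ha, ha1, hb1, hab⟩ := hf.exists_Icc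
  have hF : ∀ x, HasDerivAt (fun x => ∫ t in a..x, f t) (f x) x := fun x =>
    hf.continuous.integral_hasStrictDerivAt a x |>.hasDerivAt
  have hd : _root_.deriv (fun x => ∫ t in a..x, f t) = f := funext fun x => (hF x).deriv
  have hsupp : tsupport (fun x => ∫ t in a..x, f t) ⊆ Icc a b := by
    refine closure_minimal (fun x hx => ?_) isClosed_Icc
    by_contra hmem
    apply hx
    rcases lt_or_ge x a with hxa | hxa
    · refine (intervalIntegral.integral_congr fun t ht => ?_).trans intervalIntegral.integral_zero
      rw [uIcc_of_ge hxa.le] at ht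
      by_contra hne
      exact (not_lt.2 ht.2) (hab (subset_tsupport f hne)).1
    · have hxb : b < x := by
        by_contra hxb
        exact hmem ⟨hxa, not_lt.1 hxb⟩
      refine (intervalIntegral.integral_of_le hxa).trans ?_
      rw [← h0]
      refine setIntegral_eq_integral_of_forall_compl_eq_zero fun t ht => ?_
      by_contra hne
      exact ht ⟨(hab (subset_tsupport f hne)).1, (hab (subset_tsupport f hne)).2.le.trans hxb.le⟩
  refine ⟨_, ⟨?_, ?_, ?_⟩, hd⟩
  · rw [contDiff_infty_iff_deriv]
    exact ⟨fun x => (hF x).differentiableAt, by rw [hd]; exact hf.1⟩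
  · exact isCompact_Icc.of_isClosed_subset isClosed_closure hsupp
  · exact fun x hx => ha.trans_le (hsupp hx).1

theorem exists_integral_eq_one : ∃ η, IsHalfLineTest η ∧ ∫ x, η x = 1 := by
  let φ : ContDiffBump (2 : ℝ) := ⟨1 / 2, 1, by norm_num, by norm_num⟩
  refine ⟨fun x => ((φ.normed volume x : ℝ) : ℂ), ⟨?_, ?_, ?_⟩, ?_⟩
  · exact Complex.ofRealCLM.contDiff.comp φ.contDiff_normed
  · exact φ.hasCompactSupport_normed.comp_left Complex.ofReal_zero
  · have hs : tsupport (fun x => ((φ.normed volume x : ℝ) : ℂ)) ⊆ tsupport (φ.normed volume) :=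
      closure_mono fun x hx hfx => hx (by simp [hfx])
    refine hs.trans ?_
    rw [φ.tsupport_normed_eq]
    intro x hx
    rw [Metric.mem_closedBall, Real.dist_eq, abs_le] at hx
    have : φ.rOut = 1 := rfl
    rw [mem_Ioi]; linarith [hx.1]
  · rw [integral_complex_ofReal, φ.integral_normed]; simp

theorem ofReal {g : ℝ → ℝ} (h1 : ContDiff ℝ (⊤ : ℕ∞) g) (h2 : HasCompactSupport g)
    (h3 : tsupport g ⊆ Ioi 0) : IsHalfLineTest (fun x => (g x : ℂ)) := by
  have hs : tsupport (fun x => (g x : ℂ)) ⊆ tsupport g :=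
    closure_mono fun x hx hfx => hx (by simp [hfx])
  exact ⟨Complex.ofRealCLM.contDiff.comp h1, h2.comp_left Complex.ofReal_zero, hs.trans h3⟩

end IsHalfLineTest

theorem ae_eq_zero_of_integral_isHalfLineTest_mul {w : ℝ → ℂ}
    (hw : LocallyIntegrableOn w (Ioi 0)) (h : ∀ f, IsHalfLineTest f → ∫ x, f x * w x = 0) :
    ∀ᵐ x, 0 < x → w x = 0 := by
  refine isOpen_Ioi.ae_eq_zero_of_integral_contDiff_smul_eq_zero hw fun g h1 h2 h3 => ?_
  simpa using h _ (IsHalfLineTest.ofReal h1 h2 h3)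

/-- The lemma of du Bois-Reymond. -/
theorem ae_eq_const_of_integral_deriv_mul {w : ℝ → ℂ} (hw : LocallyIntegrableOn w (Ioi 0))
    (h : ∀ f, IsHalfLineTest f → ∫ x, deriv f x * w x = 0) :
    ∃ C : ℂ, ∀ᵐ x, 0 < x → w x = C := by
  obtain ⟨η, hη, hη1⟩ := IsHalfLineTest.exists_integral_eq_one
  refine ⟨∫ x, η x * w x, ?_⟩
  have hcl : ∀ c : ℂ, LocallyIntegrableOn (fun _ : ℝ => c) (Ioi 0) := fun c =>
    continuousOn_const.locallyIntegrableOn measurableSet_Ioi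
  have := ae_eq_zero_of_integral_isHalfLineTest_mul (hw.sub (hcl (∫ x, η x * w x))) fun f hf => ?_
  · filter_upwards [this] with x hx h0
    exact sub_eq_zero.1 (hx h0)
  have hg := hf.sub (hη.const_mul (∫ x, f x))
  obtain ⟨F, hF, hFd⟩ := hg.exists_primitive (by
    rw [integral_sub hf.integrable (hη.integrable.const_mul _), integral_const_mul, hη1,
      mul_one, sub_self])
  have h0 := h F hF
  rw [hFd] at h0
  have e1 : ∀ x, (f x - (∫ x, f x) * η x) * w x = f x * w x - (∫ x, f x) * (η x * w x) := by
    intro x; ring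
  simp only [e1] at h0
  rw [integral_sub (hf.integrable_mul hw) ((hη.integrable_mul hw).const_mul _),
    integral_const_mul] at h0
  simp only [Pi.sub_apply, mul_sub]
  rw [integral_sub (hf.integrable_mul hw) (hf.integrable_mul (hcl _)), integral_mul_const]
  exact h0

theorem ae_eq_affine_of_integral_deriv_deriv_mul {w : ℝ → ℂ}
    (hw : LocallyIntegrableOn w (Ioi 0))
    (h : ∀ f, IsHalfLineTest f → ∫ x, deriv (deriv f) x * w x = 0) :
    ∃ C D : ℂ, ∀ᵐ x, 0 < x → w x = C + D * x := by
  obtain ⟨η, hη, hη1⟩ := IsHalfLineTest.exists_integral_eq_one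
  set k : ℂ := ∫ x, deriv η x * w x with hk
  have hlin : LocallyIntegrableOn (fun x : ℝ => k * (x : ℂ)) (Ioi 0) :=
    Continuous.continuousOn (by fun_prop) |>.locallyIntegrableOn measurableSet_Ioi
  obtain ⟨C, hC⟩ := ae_eq_const_of_integral_deriv_mul (hw.add hlin) fun f hf => by
    have hg := hf.sub (hη.const_mul (∫ x, f x))
    obtain ⟨F, hF, hFd⟩ := hg.exists_primitive (by
      rw [integral_sub hf.integrable (hη.integrable.const_mul _), integral_const_mul, hη1,
        mul_one, sub_self])
    have h0 := h F hF
    have e1 : ∀ x, deriv (deriv F) x * w x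
        = deriv f x * w x - (∫ x, f x) * (deriv η x * w x) := by
      intro x
      have hd : HasDerivAt (fun x => f x - (∫ x, f x) * η x) _ x :=
        (hf.hasDerivAt x).sub ((hη.hasDerivAt x).const_mul _)
      rw [hFd, hd.deriv]
      ring
    simp only [e1] at h0
    rw [integral_sub (hf.deriv.integrable_mul hw) ((hη.deriv.integrable_mul hw).const_mul _),
      integral_const_mul, ← hk] at h0
    have h1 : ∫ x, deriv f x * (k * (x : ℂ)) = -∫ x, f x * k := by
      refine hf.integral_deriv_mul (fun x _ => ?_)
        (continuousOn_const.locallyIntegrableOn measurableSet_Ioi)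
      simpa using (Complex.ofRealCLM.hasDerivAt (x := x)).const_mul k
    simp only [Pi.add_apply, mul_add]
    rw [integral_add (hf.deriv.integrable_mul hw) (hf.deriv.integrable_mul hlin), h1,
      integral_mul_const]
    linear_combination h0
  refine ⟨C, -k, ?_⟩
  filter_upwards [hC] with x hx h0
  have := hx h0
  simp only [Pi.add_apply] at this
  linear_combination this

theorem MeasureTheory.LocallyIntegrableOn.intervalIntegrable_Ioi {w : ℝ → ℂ}
    (hw : LocallyIntegrableOn w (Ioi 0)) {a b : ℝ} (ha : 0 < a) (hb : 0 < b) :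
    IntervalIntegrable w volume a b := by
  rw [intervalIntegrable_iff']
  refine hw.integrableOn_compact_subset (fun x hx => ?_) isCompact_uIcc
  exact (lt_min ha hb).trans_le hx.1

theorem continuousOn_integral_Ioi {w : ℝ → ℂ} (hw : LocallyIntegrableOn w (Ioi 0)) :
    ContinuousOn (fun x => ∫ t in (1 : ℝ)..x, w t) (Ioi 0) := by
  intro x hx
  have hx0 : 0 < x := hx
  have h1 : ContinuousOn (fun x => ∫ t in (1 : ℝ)..x, w t) (uIcc (min (x / 2) 1) (max (2 * x) 1)) := by
    refine intervalIntegral.continuousOn_primitive_interval' (hw.intervalIntegrable_Ioi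
      (by positivity) (by positivity)) ?_
    rw [uIcc_of_le ((min_le_right _ _).trans (le_max_right _ _))]
    exact ⟨min_le_right _ _, le_max_right _ _⟩
  refine (h1.continuousAt ?_).continuousWithinAt
  rw [uIcc_of_le ((min_le_right _ _).trans (le_max_right _ _))]
  refine Icc_mem_nhds ((min_le_left _ _).trans_lt (by linarith))
    (lt_of_lt_of_le (by linarith) (le_max_left _ _))

/-- Integration by parts of a test function against a primitive of a locally integrable
function. -/
theorem IsHalfLineTest.integral_deriv_mul_primitive {f w : ℝ → ℂ} (hf : IsHalfLineTest f)
    (hw : LocallyIntegrableOn w (Ioi 0)) :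
    ∫ x, _root_.deriv f x * (∫ t in (1 : ℝ)..x, w t) = -∫ x, f x * w x := by
  obtain ⟨a, b, ha, ha1, hb1, hab⟩ := hf.exists_Icc
  have hab' : a ≤ b := (ha1.trans hb1).le
  have hsub : ∀ x, x ∉ Ioc a b → f x = 0 := fun x hx => by
    by_contra hne
    have hmem := hab (subset_tsupport f hne)
    exact hx ⟨hmem.1, hmem.2.le⟩
  have hsub' : ∀ x, x ∉ Ioc a b → _root_.deriv f x = 0 := fun x hx => by
    by_contra hne
    have hmem := hab (support_deriv_subset hne)
    exact hx ⟨hmem.1, hmem.2.le⟩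
  set μ : Measure ℝ := volume.restrict (Ioc a b) with hμ
  have hwi : IntervalIntegrable w volume a b := hw.intervalIntegrable_Ioi ha (ha.trans_le hab')
  have hwμ : Integrable w μ := hwi.1
  have hfμ : Integrable (_root_.deriv f) μ := hf.deriv.integrable.restrict
  have hdecomp : ∀ x ∈ Ioc a b, _root_.deriv f x * (∫ t in (1 : ℝ)..x, w t)
      = _root_.deriv f x * (∫ t in (1 : ℝ)..a, w t) + _root_.deriv f x * ∫ t in a..x, w t := by
    intro x hx
    rw [← mul_add, intervalIntegral.integral_add_adjacent_intervals
      (hw.intervalIntegrable_Ioi one_pos ha) (hw.intervalIntegrable_Ioi ha (ha.trans hx.1))]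
  have hS : MeasurableSet {p : ℝ × ℝ | p.2 ≤ p.1} := measurableSet_le measurable_snd measurable_fst
  have hprod : Integrable (Function.uncurry fun x t : ℝ =>
      {p : ℝ × ℝ | p.2 ≤ p.1}.indicator (fun p => _root_.deriv f p.1 * w p.2) (x, t)) (μ.prod μ) :=
    (hfμ.mul_prod hwμ).indicator hS
  have hswap := integral_integral_swap hprod
  have hL : ∀ x ∈ Ioc a b, ∫ t, {p : ℝ × ℝ | p.2 ≤ p.1}.indicator
      (fun p => _root_.deriv f p.1 * w p.2) (x, t) ∂μ = _root_.deriv f x * ∫ t in a..x, w t := by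
    intro x hx
    have e : (fun t => {p : ℝ × ℝ | p.2 ≤ p.1}.indicator (fun p => _root_.deriv f p.1 * w p.2) (x, t))
        = (Iic x).indicator fun t => _root_.deriv f x * w t := by
      ext t; simp [indicator]
    rw [e, integral_indicator measurableSet_Iic, hμ, Measure.restrict_restrict measurableSet_Iic,
      inter_comm, Ioc_inter_Iic, min_eq_right hx.2, integral_const_mul,
      intervalIntegral.integral_of_le hx.1.le]
  have hR : ∀ t ∈ Ioc a b, ∫ x, {p : ℝ × ℝ | p.2 ≤ p.1}.indicator
      (fun p => _root_.deriv f p.1 * w p.2) (x, t) ∂μ = -(f t * w t) := by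
    intro t ht
    have e : (fun x => {p : ℝ × ℝ | p.2 ≤ p.1}.indicator (fun p => _root_.deriv f p.1 * w p.2) (x, t))
        = (Ici t).indicator fun x => _root_.deriv f x * w t := by
      ext x; simp [indicator]
    rw [e, integral_indicator measurableSet_Ici, integral_Ici_eq_integral_Ioi, hμ,
      Measure.restrict_restrict measurableSet_Ioi, inter_comm, ← Ioi_inter_Iic, inter_right_comm,
      Ioi_inter_Ioi, max_eq_right ht.1.le, Ioi_inter_Iic, integral_mul_const,
      ← intervalIntegral.integral_of_le ht.2,
      intervalIntegral.integral_eq_sub_of_hasDerivAt (fun x _ => hf.hasDerivAt x)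
        hf.deriv.integrable.intervalIntegrable]
    have hb0 : f b = 0 := by
      by_contra hne; exact lt_irrefl _ (hab (subset_tsupport f hne)).2
    rw [hb0]; ring
  rw [← setIntegral_eq_integral_of_forall_compl_eq_zero (s := Ioc a b)
      (fun x hx => by rw [hsub' x hx, zero_mul]),
    ← setIntegral_eq_integral_of_forall_compl_eq_zero (s := Ioc a b) (f := fun x => f x * w x)
      (fun x hx => by rw [hsub x hx, zero_mul]),
    setIntegral_congr_fun measurableSet_Ioc hdecomp, ← integral_neg,
    ← setIntegral_congr_fun measurableSet_Ioc hR, ← hswap,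
    setIntegral_congr_fun (f := fun x => ∫ t, {p : ℝ × ℝ | p.2 ≤ p.1}.indicator
      (fun p => _root_.deriv f p.1 * w p.2) (x, t) ∂μ) measurableSet_Ioc hL, integral_add, integral_mul_const,
    setIntegral_eq_integral_of_forall_compl_eq_zero hsub', hf.integral_deriv, zero_mul, zero_add]
  · exact hfμ.mul_const _
  · refine (hprod.integral_prod_left).congr ?_
    filter_upwards [ae_restrict_mem measurableSet_Ioc] with x hx using hL x hx

/-- A locally integrable distributional solution of `u'' = q u` on `(0, ∞)` agrees almost
everywhere with a classical solution. -/
theorem exists_classical_solution {u q : ℝ → ℂ} (hu : LocallyIntegrableOn u (Ioi 0))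
    (hq : ContinuousOn q (Ioi 0))
    (h : ∀ f, IsHalfLineTest f → ∫ x, deriv (deriv f) x * u x = ∫ x, f x * (q x * u x)) :
    ∃ v v' : ℝ → ℂ, (∀ x, 0 < x → HasDerivAt v (v' x) x) ∧
      (∀ x, 0 < x → HasDerivAt v' (q x * v x) x) ∧ ∀ᵐ x, 0 < x → u x = v x := by
  have hqu : LocallyIntegrableOn (fun x => q x * u x) (Ioi 0) := by
    rw [locallyIntegrableOn_iff isOpen_Ioi.isLocallyClosed] at hu ⊢
    exact fun k hk hkc => (hu k hk hkc).continuousOn_mul (hq.mono hk) hkc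
  set p : ℝ → ℂ := fun x => ∫ t in (1 : ℝ)..x, q t * u t with hp
  have hpc : ContinuousOn p (Ioi 0) := continuousOn_integral_Ioi hqu
  have hprim : ∀ g : ℝ → ℂ, ContinuousOn g (Ioi 0) → ∀ x, 0 < x →
      HasDerivAt (fun x => ∫ t in (1 : ℝ)..x, g t) (g x) x := by
    intro g hg x hx
    refine intervalIntegral.integral_hasDerivAt_right
      ((hg.locallyIntegrableOn measurableSet_Ioi).intervalIntegrable_Ioi one_pos hx)
      (hg.stronglyMeasurableAtFilter isOpen_Ioi x hx)
      (hg.continuousAt (Ioi_mem_nhds hx))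
  set P : ℝ → ℂ := fun x => ∫ t in (1 : ℝ)..x, p t with hP
  have hPd : ∀ x, 0 < x → HasDerivAt P (p x) x := hprim p hpc
  have hPl : LocallyIntegrableOn P (Ioi 0) :=
    ContinuousOn.locallyIntegrableOn (fun x hx => (hPd x hx).continuousAt.continuousWithinAt)
      measurableSet_Ioi
  obtain ⟨C, D, hCD⟩ := ae_eq_affine_of_integral_deriv_deriv_mul (hu.sub hPl) fun f hf => by
    simp only [Pi.sub_apply, mul_sub]
    rw [integral_sub (hf.deriv.deriv.integrable_mul hu) (hf.deriv.deriv.integrable_mul hPl),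
      hf.deriv.integral_deriv_mul hPd (hpc.locallyIntegrableOn measurableSet_Ioi),
      hf.integral_deriv_mul_primitive hqu, h f hf]
    ring
  have hae : ∀ᵐ x, 0 < x → u x = P x + (C + D * x) := by
    filter_upwards [hCD] with x hx h0
    have := hx h0
    simp only [Pi.sub_apply] at this
    linear_combination this
  have hvd : ∀ x, 0 < x → HasDerivAt (fun x : ℝ => P x + (C + D * x)) (p x + D) x := fun x hx => by
    have h2 := ((Complex.ofRealCLM.hasDerivAt (x := x)).const_mul D).const_add C
    have h3 := (hPd x hx).fun_add h2
    simpa using h3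
  refine ⟨_, fun x => p x + D, hvd, fun x hx => ?_, hae⟩
  have hvc : ContinuousOn (fun x : ℝ => q x * (P x + (C + D * x))) (Ioi 0) :=
    hq.mul fun x hx => (hvd x hx).continuousAt.continuousWithinAt
  refine (((hprim _ hvc x hx).congr_of_eventuallyEq ?_)).add_const D
  filter_upwards [Ioi_mem_nhds hx] with y hy
  refine intervalIntegral.integral_congr_ae ?_
  filter_upwards [hae] with t ht htm
  rw [ht ((lt_min one_pos hy).trans htm.1)]

/-- In the limit point case, the equation `u'' = q u` with `Re q ≥ 3 / (4 x²)` has no nontrivial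
square integrable solution on `(0, ∞)`. -/
theorem eq_zero_of_hasDerivAt_of_integrableOn_sq {u u' q : ℝ → ℂ}
    (hu : ∀ x, 0 < x → HasDerivAt u (u' x) x) (hu' : ∀ x, 0 < x → HasDerivAt u' (q x * u x) x)
    (hq : ∀ x, 0 < x → 3 / (4 * x ^ 2) ≤ (q x).re)
    (hint : IntegrableOn (fun x => ‖u x‖ ^ 2) (Ioi 0)) {r : ℝ} (hr : 0 < r) : u r = 0 := by
  have hre : ∀ {v : ℝ → ℂ} {v' : ℂ} {x : ℝ}, HasDerivAt v v' x →
      HasDerivAt (fun x => (v x).re) v'.re x := fun hv =>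
    Complex.reCLM.hasFDerivAt.comp_hasDerivAt _ hv
  have him : ∀ {v : ℝ → ℂ} {v' : ℂ} {x : ℝ}, HasDerivAt v v' x →
      HasDerivAt (fun x => (v x).im) v'.im x := fun hv =>
    Complex.imCLM.hasFDerivAt.comp_hasDerivAt _ hv
  have hnorm : ∀ x, ‖u x‖ ^ 2 = (u x).re ^ 2 + (u x).im ^ 2 := fun x => by
    rw [← Complex.normSq_eq_norm_sq, Complex.normSq_apply]; ring
  simp only [hnorm] at hint
  set n : ℝ → ℝ := fun x => (u x).re ^ 2 + (u x).im ^ 2 with hn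
  set K : ℝ → ℝ := fun x => n x / (2 * x) + ((u x).re * (u' x).re + (u x).im * (u' x).im) with hK
  set Z : ℝ → ℝ := fun x => x * n x with hZ
  have hnd : ∀ x, 0 < x →
      HasDerivAt n (2 * ((u x).re * (u' x).re + (u x).im * (u' x).im)) x := fun x hx => by
    have h := ((hre (hu x hx)).fun_pow 2).fun_add ((him (hu x hx)).fun_pow 2)
    refine h.congr_deriv ?_
    norm_num
    ring
  have hZd : ∀ x, 0 < x → HasDerivAt Z (2 * x * K x) x := fun x hx => by
    have h : HasDerivAt Z _ x := (hasDerivAt_id' x).fun_mul (hnd x hx)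
    refine h.congr_deriv ?_
    simp only [K]
    field_simp
  have hKd : ∀ x, 0 < x → ∃ k, 0 ≤ k ∧ HasDerivAt K k x := fun x hx => by
    have h1 := (hnd x hx).fun_div ((hasDerivAt_id' x).const_mul 2) (by positivity)
    have h2 := ((hre (hu x hx)).fun_mul (hre (hu' x hx))).fun_add
      ((him (hu x hx)).fun_mul (him (hu' x hx)))
    refine ⟨_, ?_, h1.fun_add h2⟩
    have e : (2 * ((u x).re * (u' x).re + (u x).im * (u' x).im) * (2 * x)
        - n x * (2 * 1)) / (2 * x) ^ 2 + ((u' x).re * (u' x).re + (u x).re * (q x * u x).re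
        + ((u' x).im * (u' x).im + (u x).im * (q x * u x).im))
        = ((u' x).re + (u x).re / (2 * x)) ^ 2 + ((u' x).im + (u x).im / (2 * x)) ^ 2
        + ((q x).re - 3 / (4 * x ^ 2)) * n x := by
      simp only [n, Complex.mul_re, Complex.mul_im]
      field_simp
      ring
    rw [e]
    have := mul_nonneg (sub_nonneg.2 (hq x hx)) (show 0 ≤ n x by positivity)
    positivity
  have hKm : MonotoneOn K (Ioi 0) := by
    refine monotoneOn_of_deriv_nonneg (convex_Ioi 0) (fun x hx => ?_) (fun x hx => ?_)
      fun x hx => ?_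
    · obtain ⟨k, -, h⟩ := hKd x hx
      exact h.continuousAt.continuousWithinAt
    · obtain ⟨k, -, h⟩ := hKd x (interior_subset hx)
      exact h.differentiableAt.differentiableWithinAt
    · obtain ⟨k, hk, h⟩ := hKd x (interior_subset hx)
      rwa [h.deriv]
  by_contra hne
  have hn0 : 0 < n r := by
    rw [show n r = ‖u r‖ ^ 2 from (hnorm r).symm]; positivity
  have hZ0 : 0 < Z r := mul_pos hr hn0
  have hinv : ∀ s ⊆ Ioi (0 : ℝ), MeasurableSet s → (∀ x ∈ s, Z r ≤ Z x) →
      IntegrableOn (fun x : ℝ => x⁻¹) s := by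
    intro s hs hsm hZs
    refine Integrable.mono' ((hint.mono_set hs).const_mul (Z r)⁻¹)
      measurable_inv.aestronglyMeasurable ?_
    filter_upwards [ae_restrict_mem hsm] with x hx
    have hx0 : 0 < x := hs hx
    have := hZs x hx
    rw [Real.norm_of_nonneg (by positivity), inv_mul_eq_div, le_div_iff₀ hZ0,
      inv_mul_le_iff₀ hx0]
    exact this
  rcases le_total 0 (K r) with hKr | hKr
  · have hmono : MonotoneOn Z (Ici r) := by
      refine monotoneOn_of_deriv_nonneg (convex_Ici r)
        (fun x hx => (hZd x (hr.trans_le hx)).continuousAt.continuousWithinAt)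
        (fun x hx => (hZd x (hr.trans_le (interior_subset hx))).differentiableAt.differentiableWithinAt)
        fun x hx => ?_
      have hx' : r ≤ x := interior_subset hx
      have hx0 := hr.trans_le hx'
      rw [(hZd x hx0).deriv]
      have := hKr.trans (hKm hr hx0 hx')
      positivity
    exact not_integrableOn_Ioi_inv (hinv (Ioi r) (Ioi_subset_Ioi hr.le) measurableSet_Ioi
      fun x hx => hmono self_mem_Ici (Ioi_subset_Ici_self hx) (le_of_lt hx))
  · have hanti : AntitoneOn Z (Ioc 0 r) := by
      refine antitoneOn_of_deriv_nonpos (convex_Ioc 0 r)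
        (fun x hx => (hZd x hx.1).continuousAt.continuousWithinAt)
        (fun x hx => (hZd x (interior_subset hx).1).differentiableAt.differentiableWithinAt)
        fun x hx => ?_
      have hx' := interior_subset hx
      rw [(hZd x hx'.1).deriv]
      have h1 := (hKm hx'.1 hr hx'.2).trans hKr
      have h2 := hx'.1
      exact mul_nonpos_of_nonneg_of_nonpos (by positivity) h1
    have h := hinv (Ioc 0 r) (fun x hx => hx.1) measurableSet_Ioc
      fun x hx => hanti hx ⟨hr, le_rfl⟩ hx.2
    rw [← intervalIntegrable_iff_integrableOn_Ioc_of_le hr.le, intervalIntegrable_inv_iff] at h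
    rcases h with h | h
    · exact hr.ne h
    · exact h left_mem_uIcc

section Operator

open scoped ComplexConjugate

local notation "L²ℝ₊" => Lp ℂ 2 halfLineMeasure

variable {ν : ℝ} {T : L²ℝ₊ →ₗ.[ℂ] L²ℝ₊}

theorem ae_halfLineMeasure_iff {p : ℝ → Prop} :
    (∀ᵐ x ∂halfLineMeasure, p x) ↔ ∀ᵐ x, 0 < x → p x :=
  ae_restrict_iff' measurableSet_Ioi

theorem locallyIntegrableOn_conj_Lp (F : L²ℝ₊) :
    LocallyIntegrableOn (fun x => conj (F x)) (Ioi 0) := by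
  have : IsLocallyFiniteMeasure halfLineMeasure :=
    inferInstanceAs (IsLocallyFiniteMeasure (volume.restrict (Ioi 0)))
  have h : LocallyIntegrable (fun x => conj (F x)) halfLineMeasure :=
    (MemLp.star (Lp.memLp F)).locallyIntegrable (by norm_num)
  exact locallyIntegrableOn_of_locallyIntegrable_restrict h

theorem locallyIntegrableOn_const_div_sq_mul (c : ℝ) {ψ : ℝ → ℂ}
    (hψ : LocallyIntegrableOn ψ (Ioi 0)) :
    LocallyIntegrableOn (fun x => ((c / x ^ 2 : ℝ) : ℂ) * ψ x) (Ioi 0) := by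
  rw [locallyIntegrableOn_iff isOpen_Ioi.isLocallyClosed] at hψ ⊢
  refine fun k hk hkc => (hψ k hk hkc).continuousOn_mul ?_ hkc
  refine Complex.continuous_ofReal.comp_continuousOn
    (continuousOn_const.div (by fun_prop) fun x hx => ?_)
  have : 0 < x := hk hx
  positivity

theorem inner_eq_integral_test_mul {f ψ : ℝ → ℂ} (hf : IsHalfLineTest f) {F w : L²ℝ₊}
    (hF : ∀ᵐ x, 0 < x → conj (F x) = ψ x) (hw : ⇑w =ᵐ[halfLineMeasure] f) :
    inner ℂ F w = ∫ x, f x * ψ x := by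
  rw [L2.inner_def, ← hf.setIntegral_mul]
  refine integral_congr_ae ?_
  filter_upwards [hw, ae_halfLineMeasure_iff.2 hF] with x h1 h2
  rw [RCLike.inner_apply, h1, h2]

theorem inner_eq_integral_besselOp_mul {f ψ : ℝ → ℂ} (hf : IsHalfLineTest f) {F w : L²ℝ₊}
    (hF : ∀ᵐ x, 0 < x → conj (F x) = ψ x) (hψ : LocallyIntegrableOn ψ (Ioi 0))
    (hw : ⇑w =ᵐ[halfLineMeasure] besselOp ν f) :
    inner ℂ F w = (∫ x, deriv (deriv f) x * ψ x)
      - ∫ x, f x * ((((ν ^ 2 - 1 / 4) / x ^ 2 : ℝ) : ℂ) * ψ x) := by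
  have hi := locallyIntegrableOn_const_div_sq_mul (ν ^ 2 - 1 / 4) hψ
  rw [L2.inner_def, ← integral_sub (hf.deriv.deriv.integrable_mul hψ) (hf.integrable_mul hi)]
  refine Eq.trans (integral_congr_ae ?_)
    (setIntegral_eq_integral_of_forall_compl_eq_zero (s := Ioi 0) fun x hx => by
      rw [hf.eq_zero_of_nonpos (not_lt.1 hx), hf.deriv.deriv.eq_zero_of_nonpos (not_lt.1 hx)]
      ring)
  filter_upwards [hw, ae_halfLineMeasure_iff.2 hF] with x h1 h2
  rw [RCLike.inner_apply, h1, h2, besselOp]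
  ring

theorem IsHalfLineTest.memLp {f : ℝ → ℂ} (hf : IsHalfLineTest f) : MemLp f 2 halfLineMeasure :=
  (hf.continuous.memLp_of_hasCompactSupport hf.2.1).restrict _

theorem exists_mem_domain (hdom : ∀ F : L²ℝ₊,
      F ∈ T.domain ↔ ∃ f, IsHalfLineTest f ∧ ⇑F =ᵐ[halfLineMeasure] f)
    {f : ℝ → ℂ} (hf : IsHalfLineTest f) : ∃ w : T.domain, ⇑(w : L²ℝ₊) =ᵐ[halfLineMeasure] f :=
  ⟨⟨hf.memLp.toLp f, (hdom _).2 ⟨f, hf, hf.memLp.coeFn_toLp⟩⟩, hf.memLp.coeFn_toLp⟩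

theorem dense_domain (hdom : ∀ F : L²ℝ₊,
      F ∈ T.domain ↔ ∃ f, IsHalfLineTest f ∧ ⇑F =ᵐ[halfLineMeasure] f) :
    Dense (T.domain : Set L²ℝ₊) := by
  rw [Submodule.dense_iff_topologicalClosure_eq_top, Submodule.topologicalClosure_eq_top_iff,
    Submodule.eq_bot_iff]
  intro F hF
  have h0 := ae_eq_zero_of_integral_isHalfLineTest_mul (locallyIntegrableOn_conj_Lp F)
    fun f hf => by
      obtain ⟨w, hw⟩ := exists_mem_domain hdom hf
      rw [← inner_eq_integral_test_mul hf (Filter.Eventually.of_forall fun x _ => rfl) hw]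
      exact (Submodule.mem_orthogonal' _ _).1 hF w w.2
  rw [Lp.eq_zero_iff_ae_eq_zero]
  refine (ae_halfLineMeasure_iff.2 h0).mono fun x hx => ?_
  simpa using hx

/-- Green's identity: on classical functions the adjoint acts as the differential expression. -/
theorem inner_eq_inner_apply_of_hasDerivAt
    (hact : ∀ (w : T.domain) (f : ℝ → ℂ), IsHalfLineTest f →
      ⇑(w : L²ℝ₊) =ᵐ[halfLineMeasure] f → ⇑(T w) =ᵐ[halfLineMeasure] besselOp ν f)
    {F G : L²ℝ₊} {ψ ψ' ψ'' : ℝ → ℂ} (hψ : ∀ x, 0 < x → HasDerivAt ψ (ψ' x) x)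
    (hψ' : ∀ x, 0 < x → HasDerivAt ψ' (ψ'' x) x) (hψ'' : LocallyIntegrableOn ψ'' (Ioi 0))
    (hF : ∀ᵐ x, 0 < x → conj (F x) = ψ x)
    (hG : ∀ᵐ x, 0 < x → conj (G x) = ψ'' x - (((ν ^ 2 - 1 / 4) / x ^ 2 : ℝ) : ℂ) * ψ x)
    {f : ℝ → ℂ} (hf : IsHalfLineTest f) (w : T.domain)
    (hw : ⇑(w : L²ℝ₊) =ᵐ[halfLineMeasure] f) :
    inner ℂ G (w : L²ℝ₊) = inner ℂ F (T w) := by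
  have hψl : LocallyIntegrableOn ψ (Ioi 0) :=
    ContinuousOn.locallyIntegrableOn (fun x hx => (hψ x hx).continuousAt.continuousWithinAt)
      measurableSet_Ioi
  rw [inner_eq_integral_test_mul hf hG hw,
    inner_eq_integral_besselOp_mul hf hF hψl (hact w f hf hw),
    hf.integral_deriv_deriv_mul hψ hψ' hψ'']
  simp only [mul_sub]
  exact integral_sub (hf.integrable_mul hψ'')
    (hf.integrable_mul (locallyIntegrableOn_const_div_sq_mul _ hψl))

theorem isFormalAdjoint_self (hdom : ∀ F : L²ℝ₊,
      F ∈ T.domain ↔ ∃ f, IsHalfLineTest f ∧ ⇑F =ᵐ[halfLineMeasure] f)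
    (hact : ∀ (w : T.domain) (f : ℝ → ℂ), IsHalfLineTest f →
      ⇑(w : L²ℝ₊) =ᵐ[halfLineMeasure] f → ⇑(T w) =ᵐ[halfLineMeasure] besselOp ν f) :
    T.IsFormalAdjoint T := by
  intro v w
  obtain ⟨g, hg, hvg⟩ := (hdom v).1 v.2
  obtain ⟨f, hf, hwf⟩ := (hdom w).1 w.2
  have hconj : ∀ {k : ℝ → ℂ}, IsHalfLineTest k → ∀ x, 0 < x →
      HasDerivAt (fun x => conj (k x)) (conj (deriv k x)) x := fun hk x _ =>
    Complex.conjCLE.hasFDerivAt.comp_hasDerivAt x (hk.hasDerivAt x)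
  refine inner_eq_inner_apply_of_hasDerivAt hact (hconj hg) (hconj hg.deriv)
    (hg.deriv.deriv.star.continuous.continuousOn.locallyIntegrableOn measurableSet_Ioi)
    ?_ ?_ hf w hwf
  · refine ae_halfLineMeasure_iff.1 (hvg.mono fun x hx => ?_)
    rw [hx]
  · refine ae_halfLineMeasure_iff.1 ((hact v g hg hvg).mono fun x hx => ?_)
    rw [hx, besselOp, map_sub, map_mul, Complex.conj_ofReal]

theorem eq_zero_of_adjoint_apply_eq_smul (hν : 1 ≤ |ν|) (hdom : ∀ F : L²ℝ₊,
      F ∈ T.domain ↔ ∃ f, IsHalfLineTest f ∧ ⇑F =ᵐ[halfLineMeasure] f)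
    (hact : ∀ (w : T.domain) (f : ℝ → ℂ), IsHalfLineTest f →
      ⇑(w : L²ℝ₊) =ᵐ[halfLineMeasure] f → ⇑(T w) =ᵐ[halfLineMeasure] besselOp ν f)
    {z : ℂ} (hz : z.re = 0) (F : T.adjoint.domain) (hF : T.adjoint F = z • (F : L²ℝ₊)) :
    (F : L²ℝ₊) = 0 := by
  have hT := dense_domain hdom
  have hFl := locallyIntegrableOn_conj_Lp (F : L²ℝ₊)
  have hFl2 := locallyIntegrableOn_const_div_sq_mul (ν ^ 2 - 1 / 4) hFl
  obtain ⟨v, v', hv, hv', hFv⟩ := exists_classical_solution hFl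
    (q := fun x => (((ν ^ 2 - 1 / 4) / x ^ 2 : ℝ) : ℂ) + conj z) (by
      refine (Complex.continuous_ofReal.comp_continuousOn
        (continuousOn_const.div (by fun_prop) fun x hx => ?_)).add continuousOn_const
      have : 0 < x := hx
      positivity) fun f hf => by
    obtain ⟨w, hw⟩ := exists_mem_domain hdom hf
    have h1 := LinearPMap.adjoint_isFormalAdjoint hT F w
    have hFF : ∀ᵐ x, 0 < x → conj ((F : L²ℝ₊) x) = conj ((F : L²ℝ₊) x) :=
      Filter.Eventually.of_forall fun x _ => rfl
    rw [hF, inner_smul_left, inner_eq_integral_test_mul hf hFF hw,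
      inner_eq_integral_besselOp_mul hf hFF hFl (hact w f hf hw)] at h1
    have e : ∀ x, f x * (((((ν ^ 2 - 1 / 4) / x ^ 2 : ℝ) : ℂ) + conj z) * conj ((F : L²ℝ₊) x))
        = f x * ((((ν ^ 2 - 1 / 4) / x ^ 2 : ℝ) : ℂ) * conj ((F : L²ℝ₊) x))
          + conj z * (f x * conj ((F : L²ℝ₊) x)) := fun x => by ring
    simp only [e]
    rw [integral_add (hf.integrable_mul hFl2) ((hf.integrable_mul hFl).const_mul _),
      integral_const_mul, h1]
    ring
  have hint : IntegrableOn (fun x => ‖v x‖ ^ 2) (Ioi 0) := by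
    refine ((Lp.memLp (F : L²ℝ₊)).integrable_norm_pow (by norm_num)).congr ?_
    refine (ae_halfLineMeasure_iff.2 hFv).mono fun x hx => ?_
    simp [← hx]
  have hν2 : 1 ≤ ν ^ 2 := by
    rw [← sq_abs]; exact one_le_pow₀ hν
  have hv0 : ∀ x, 0 < x → v x = 0 := fun x hx =>
    eq_zero_of_hasDerivAt_of_integrableOn_sq hv hv' (fun y hy => by
      simp only [Complex.add_re, Complex.ofReal_re, Complex.conj_re, hz, add_zero]
      rw [div_le_div_iff₀ (by positivity) (by positivity)]
      nlinarith [sq_nonneg y]) hint hx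
  rw [Lp.eq_zero_iff_ae_eq_zero]
  refine (ae_halfLineMeasure_iff.2 ?_)
  filter_upwards [hFv] with x hx h0
  simpa [hv0 x h0] using hx h0

theorem adjoint_eq_closure_of_one_le_abs (hν : 1 ≤ |ν|) (hdom : ∀ F : L²ℝ₊,
      F ∈ T.domain ↔ ∃ f, IsHalfLineTest f ∧ ⇑F =ᵐ[halfLineMeasure] f)
    (hact : ∀ (w : T.domain) (f : ℝ → ℂ), IsHalfLineTest f →
      ⇑(w : L²ℝ₊) =ᵐ[halfLineMeasure] f → ⇑(T w) =ᵐ[halfLineMeasure] besselOp ν f) :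
    T.adjoint = T.closure :=
  (isFormalAdjoint_self hdom hact).adjoint_eq_closure (dense_domain hdom)
    (eq_zero_of_adjoint_apply_eq_smul hν hdom hact Complex.I_re)
    (eq_zero_of_adjoint_apply_eq_smul hν hdom hact (by simp))

/-- A smooth cutoff equal to `1` on `(-∞, 1]` and to `0` on `[2, ∞)`, with two derivatives. -/
theorem exists_cutoff : ∃ χ χ' χ'' : ℝ → ℝ, (∀ x, HasDerivAt χ (χ' x) x) ∧
    (∀ x, HasDerivAt χ' (χ'' x) x) ∧ Continuous χ'' ∧ χ 0 = 1 ∧ (∀ x, 2 < x → χ x = 0) ∧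
    ∀ x ∉ Icc (1 : ℝ) 2, χ' x = 0 ∧ χ'' x = 0 := by
  set χ : ℝ → ℝ := fun x => Real.smoothTransition (2 - x) with hχ
  have hc : ContDiff ℝ (2 : ℕ∞) χ :=
    Real.smoothTransition.contDiff.comp (contDiff_const.sub contDiff_id)
  have hc' : ContDiff ℝ 1 (deriv χ) := ((contDiff_succ_iff_deriv (n := 1)).1 hc).2.2
  have hc'' : Continuous (deriv (deriv χ)) := hc'.continuous_deriv le_rfl
  have h1 : ∀ x ≤ 1, χ x = 1 := fun x hx => Real.smoothTransition.one_of_one_le (by linarith)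
  have h2 : ∀ x, 2 < x → χ x = 0 := fun x hx =>
    Real.smoothTransition.zero_of_nonpos (by linarith)
  refine ⟨χ, deriv χ, deriv (deriv χ),
    fun x => (hc.differentiable (by norm_num) x).hasDerivAt,
    fun x => (hc'.differentiable (by norm_num) x).hasDerivAt, hc'', h1 0 zero_le_one, h2,
    fun x hx => ?_⟩
  have hconst : ∃ c, χ =ᶠ[nhds x] fun _ => c := by
    rcases lt_or_ge x 1 with hx1 | hx1
    · exact ⟨1, Filter.eventually_of_mem (Iio_mem_nhds hx1) fun y hy => h1 y (le_of_lt hy)⟩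
    · have hx2 : 2 < x := lt_of_not_ge fun h => hx ⟨hx1, h⟩
      exact ⟨0, Filter.eventually_of_mem (Ioi_mem_nhds hx2) fun y hy => h2 y hy⟩
  obtain ⟨c, hcx⟩ := hconst
  have hd := hcx.deriv
  exact ⟨by rw [hcx.deriv_eq, deriv_const], by rw [hd.deriv_eq]; simp⟩

theorem memLp_two_of_continuousOn {g : ℝ → ℝ} (hg : ContinuousOn g (Ioi 0))
    (hint : IntegrableOn (fun x => g x ^ 2) (Icc 0 2)) (h0 : ∀ x, 2 < x → g x = 0) :
    MemLp g 2 halfLineMeasure := by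
  refine (memLp_two_iff_integrable_sq (hg.aestronglyMeasurable measurableSet_Ioi)).2 ?_
  refine IntegrableOn.of_forall_sdiff_eq_zero hint measurableSet_Ioi fun x hx => ?_
  rw [h0 x (lt_of_not_ge fun h => hx.2 ⟨le_of_lt hx.1, h⟩)]
  simp

/-- Two solutions of `l_ν a = 0` that are square integrable near `0` and have nonzero Wronskian
prevent `l_ν` from being essentially selfadjoint. -/
theorem adjoint_ne_closure_of_wronskian (hdom : ∀ F : L²ℝ₊,
      F ∈ T.domain ↔ ∃ f, IsHalfLineTest f ∧ ⇑F =ᵐ[halfLineMeasure] f)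
    (hact : ∀ (w : T.domain) (f : ℝ → ℂ), IsHalfLineTest f →
      ⇑(w : L²ℝ₊) =ᵐ[halfLineMeasure] f → ⇑(T w) =ᵐ[halfLineMeasure] besselOp ν f)
    {a a' b b' : ℝ → ℝ} {W : ℝ} (ha : ∀ x, 0 < x → HasDerivAt a (a' x) x)
    (ha' : ∀ x, 0 < x → HasDerivAt a' ((ν ^ 2 - 1 / 4) / x ^ 2 * a x) x)
    (hai : IntegrableOn (fun x => a x ^ 2) (Icc 0 2))
    (hb : ∀ x, 0 < x → HasDerivAt b (b' x) x)
    (hb' : ∀ x, 0 < x → HasDerivAt b' ((ν ^ 2 - 1 / 4) / x ^ 2 * b x) x)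
    (hbi : IntegrableOn (fun x => b x ^ 2) (Icc 0 2))
    (hW : ∀ x, 0 < x → a' x * b x - a x * b' x = W) (hW0 : W ≠ 0) :
    T.adjoint ≠ T.closure := by
  intro hadj
  obtain ⟨χ, χ', χ'', hχ, hχ', hχ'', hχ0, hχ2, hχc⟩ := exists_cutoff
  have hχcont : Continuous χ := continuous_iff_continuousAt.2 fun x => (hχ x).continuousAt
  have hχ'cont : Continuous χ' := continuous_iff_continuousAt.2 fun x => (hχ' x).continuousAt
  have cont : ∀ {s s' : ℝ → ℝ}, (∀ x, 0 < x → HasDerivAt s (s' x) x) → ContinuousOn s (Ioi 0) :=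
    fun hs x hx => (hs x hx).continuousAt.continuousWithinAt
  have hmul : ∀ {s s' : ℝ → ℝ}, (∀ x, 0 < x → HasDerivAt s (s' x) x) →
      IntegrableOn (fun x => s x ^ 2) (Icc 0 2) → MemLp (fun x => χ x * s x) 2 halfLineMeasure := by
    intro s s' hs hsi
    refine memLp_two_of_continuousOn (hχcont.continuousOn.mul (cont hs)) ?_
      fun x hx => by rw [hχ2 x hx, zero_mul]
    simp only [mul_pow]
    exact hsi.continuousOn_mul (hχcont.pow 2).continuousOn isCompact_Icc
  have hcomm : ∀ {s s' s'' : ℝ → ℝ}, (∀ x, 0 < x → HasDerivAt s (s' x) x) →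
      (∀ x, 0 < x → HasDerivAt s' (s'' x) x) →
      MemLp (fun x => χ'' x * s x + 2 * χ' x * s' x) 2 halfLineMeasure := by
    intro s s' s'' hs hs'
    have hc : ContinuousOn (fun x => χ'' x * s x + 2 * χ' x * s' x) (Ioi 0) :=
      (hχ''.continuousOn.mul (cont hs)).add
        ((continuous_const.mul hχ'cont).continuousOn.mul (cont hs'))
    have hz : ∀ x ∉ Icc (1 : ℝ) 2, χ'' x * s x + 2 * χ' x * s' x = 0 := fun x hx => by
      rw [(hχc x hx).1, (hχc x hx).2]; ring
    refine memLp_two_of_continuousOn hc ?_ fun x hx => hz x fun h => hx.not_ge h.2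
    have h12 : IntegrableOn (fun x => (χ'' x * s x + 2 * χ' x * s' x) ^ 2) (Icc 1 2) :=
      ((hc.mono fun x hx => zero_lt_one.trans_le hx.1).pow 2).integrableOn_compact isCompact_Icc
    exact h12.of_forall_sdiff_eq_zero measurableSet_Icc fun x hx => by rw [hz x hx.2]; simp
  have hmem : ∀ {s s' : ℝ → ℝ}, (∀ x, 0 < x → HasDerivAt s (s' x) x) →
      (∀ x, 0 < x → HasDerivAt s' ((ν ^ 2 - 1 / 4) / x ^ 2 * s x) x) →
      IntegrableOn (fun x => s x ^ 2) (Icc 0 2) → ∃ F : T.adjoint.domain,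
        (⇑(F : L²ℝ₊) =ᵐ[halfLineMeasure] fun x => ((χ x * s x : ℝ) : ℂ)) ∧
        ⇑(T.adjoint F) =ᵐ[halfLineMeasure]
          fun x => ((χ'' x * s x + 2 * χ' x * s' x : ℝ) : ℂ) := by
    intro s s' hs hs' hsi
    have hF : MemLp (fun x => ((χ x * s x : ℝ) : ℂ)) 2 halfLineMeasure := (hmul hs hsi).ofReal
    have hG : MemLp (fun x => ((χ'' x * s x + 2 * χ' x * s' x : ℝ) : ℂ)) 2 halfLineMeasure :=
      (hcomm hs hs').ofReal
    have key : ∀ w : T.domain, inner ℂ (hG.toLp _) (w : L²ℝ₊) = inner ℂ (hF.toLp _) (T w) := by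
      intro w
      obtain ⟨f, hf, hwf⟩ := (hdom w).1 w.2
      refine inner_eq_inner_apply_of_hasDerivAt hact
        (ψ := fun x => ((χ x * s x : ℝ) : ℂ))
        (ψ' := fun x => ((χ' x * s x + χ x * s' x : ℝ) : ℂ))
        (ψ'' := fun x => ((χ'' x * s x + χ' x * s' x
          + (χ' x * s' x + χ x * ((ν ^ 2 - 1 / 4) / x ^ 2 * s x)) : ℝ) : ℂ))
        (fun x hx => ((hχ x).fun_mul (hs x hx)).ofReal_comp)
        (fun x hx => (((hχ' x).fun_mul (hs x hx)).fun_add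
          ((hχ x).fun_mul (hs' x hx))).ofReal_comp) ?_ ?_ ?_ hf w hwf
      · refine ContinuousOn.locallyIntegrableOn ?_ measurableSet_Ioi
        have hq : ContinuousOn (fun x : ℝ => (ν ^ 2 - 1 / 4) / x ^ 2) (Ioi 0) :=
          continuousOn_const.div (by fun_prop) fun x hx => pow_ne_zero 2 (ne_of_gt hx)
        exact Complex.continuous_ofReal.comp_continuousOn
          (((hχ''.continuousOn.mul (cont hs)).add (hχ'cont.continuousOn.mul (cont hs'))).add
            ((hχ'cont.continuousOn.mul (cont hs')).add
              (hχcont.continuousOn.mul (hq.mul (cont hs)))))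
      · refine ae_halfLineMeasure_iff.1 (hF.coeFn_toLp.mono fun x hx => ?_)
        rw [hx]
        exact Complex.conj_ofReal _
      · refine ae_halfLineMeasure_iff.1 (hG.coeFn_toLp.mono fun x hx => ?_)
        rw [hx]
        refine (Complex.conj_ofReal _).trans ?_
        push_cast
        ring
    refine ⟨⟨hF.toLp _, LinearPMap.mem_adjoint_domain_of_exists _ ⟨_, key⟩⟩, hF.coeFn_toLp, ?_⟩
    rw [LinearPMap.adjoint_apply_eq (dense_domain hdom) _ key]
    exact hG.coeFn_toLp
  obtain ⟨F, hF, hTF⟩ := hmem ha ha' hai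
  obtain ⟨G, hG, hTG⟩ := hmem hb hb' hbi
  have hinner : ∀ {u v : L²ℝ₊} {g k : ℝ → ℝ}, (⇑u =ᵐ[halfLineMeasure] fun x => (g x : ℂ)) →
      (⇑v =ᵐ[halfLineMeasure] fun x => (k x : ℂ)) →
      inner ℂ u v = ((∫ x, k x * g x ∂halfLineMeasure : ℝ) : ℂ) := by
    intro u v g k hu hv
    rw [L2.inner_def, ← integral_complex_ofReal]
    refine integral_congr_ae ?_
    filter_upwards [hu, hv] with x h1 h2
    rw [RCLike.inner_apply, h1, h2, Complex.conj_ofReal, Complex.ofReal_mul]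
  have hsymm := (isFormalAdjoint_self hdom hact).adjoint_of_adjoint_eq_closure
    (dense_domain hdom) hadj F G
  have hi₁ : Integrable (fun x => χ x * b x * (χ'' x * a x + 2 * χ' x * a' x)) halfLineMeasure :=
    (hmul hb hbi).integrable_mul (hcomm ha ha')
  have hi₂ : Integrable (fun x => (χ'' x * b x + 2 * χ' x * b' x) * (χ x * a x)) halfLineMeasure :=
    (hcomm hb hb').integrable_mul (hmul ha hai)
  rw [hinner hTF hG, hinner hF hTG, Complex.ofReal_inj, ← sub_eq_zero,
    ← integral_sub hi₁ hi₂] at hsymm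
  have hae : ∀ x ∈ Ioi (0 : ℝ), χ x * b x * (χ'' x * a x + 2 * χ' x * a' x)
      - (χ'' x * b x + 2 * χ' x * b' x) * (χ x * a x) = W * (2 * χ x * χ' x) := fun x hx => by
    rw [← hW x hx]; ring
  have hint' : IntegrableOn (fun x => W * (2 * χ x * χ' x)) (Ioi 0) :=
    (hi₁.sub hi₂).congr ((ae_restrict_mem measurableSet_Ioi).mono hae)
  have hI := integral_Ioi_of_hasDerivAt_of_tendsto' (f := fun x => W * χ x ^ 2) (m := 0)
    (fun x _ => (((hχ x).fun_pow 2).const_mul W).congr_deriv (by norm_num)) hint'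
    (tendsto_const_nhds.congr' ((Filter.eventually_gt_atTop 2).mono fun x hx => by
      simp [hχ2 x hx]))
  rw [halfLineMeasure, setIntegral_congr_fun measurableSet_Ioi hae, hI, hχ0] at hsymm
  exact hW0 (by linarith)

theorem adjoint_ne_closure_of_abs_lt_one (hν : |ν| < 1) (hdom : ∀ F : L²ℝ₊,
      F ∈ T.domain ↔ ∃ f, IsHalfLineTest f ∧ ⇑F =ᵐ[halfLineMeasure] f)
    (hact : ∀ (w : T.domain) (f : ℝ → ℂ), IsHalfLineTest f →
      ⇑(w : L²ℝ₊) =ᵐ[halfLineMeasure] f → ⇑(T w) =ᵐ[halfLineMeasure] besselOp ν f) :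
    T.adjoint ≠ T.closure := by
  obtain ⟨hν1, hν2⟩ := abs_lt.1 hν
  rcases eq_or_ne ν 0 with rfl | hν0
  · have hs : ∀ x, 0 < x → HasDerivAt Real.sqrt (√x / (2 * x)) x := fun x hx => by
      refine (Real.hasDerivAt_sqrt hx.ne').congr_deriv ?_
      have h := Real.sq_sqrt hx.le
      have := Real.sqrt_pos.2 hx
      field_simp
      linarith
    have hs' : ∀ x, 0 < x → HasDerivAt (fun x => √x / (2 * x)) (-√x / (4 * x ^ 2)) x :=
      fun x hx => ((hs x hx).fun_div ((hasDerivAt_id' x).const_mul 2) (by positivity)).congr_deriv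
        (by field_simp; ring)
    refine adjoint_ne_closure_of_wronskian hdom hact (a := Real.sqrt)
      (a' := fun x => √x / (2 * x)) (b := fun x => √x * Real.log x)
      (b' := fun x => √x / (2 * x) * Real.log x + √x * x⁻¹) (W := -1) hs
      (fun x hx => (hs' x hx).congr_deriv (by ring)) ?_
      (fun x hx => (hs x hx).fun_mul (Real.hasDerivAt_log hx.ne'))
      (fun x hx => (((hs' x hx).fun_mul (Real.hasDerivAt_log hx.ne')).fun_add
        ((hs x hx).fun_mul (hasDerivAt_inv hx.ne'))).congr_deriv (by field_simp; ring)) ?_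
      (fun x hx => ?_) (by norm_num)
    · exact (Real.continuous_sqrt.pow 2).integrableOn_Icc
    · have h : ContinuousOn (fun x => (2 * (√x * Real.log √x)) ^ 2) (Icc 0 2) :=
        ((continuous_const.mul (Real.continuous_mul_log.comp Real.continuous_sqrt)).pow
          2).continuousOn
      refine (h.integrableOn_compact isCompact_Icc).congr_fun (fun x hx => ?_) measurableSet_Icc
      simp only [Real.log_sqrt hx.1]
      ring
    · have h := Real.sq_sqrt hx.le
      field_simp
      linear_combination (-2 : ℝ) * h
  · have hp : ∀ (p x : ℝ), 0 < x → HasDerivAt (fun x => x ^ p) (p * x ^ (p - 1)) x :=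
      fun p x hx => Real.hasDerivAt_rpow_const (Or.inl hx.ne')
    have hp' : ∀ p : ℝ, p * (p - 1) = ν ^ 2 - 1 / 4 → ∀ x : ℝ, 0 < x →
        HasDerivAt (fun x => p * x ^ (p - 1)) ((ν ^ 2 - 1 / 4) / x ^ 2 * x ^ p) x :=
      fun p hpν x hx => ((hp (p - 1) x hx).const_mul p).congr_deriv (by
        rw [← hpν, Real.rpow_sub_one hx.ne', Real.rpow_sub_one hx.ne']
        field_simp)
    have hpi : ∀ p : ℝ, -1 < p * 2 → IntegrableOn (fun x : ℝ => (x ^ p) ^ 2) (Icc 0 2) := by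
      intro p hp
      have h := intervalIntegral.intervalIntegrable_rpow' (a := 0) (b := 2) hp
      rw [intervalIntegrable_iff_integrableOn_Icc_of_le zero_le_two] at h
      refine h.congr_fun (fun x hx => ?_) measurableSet_Icc
      simp only [Real.rpow_mul hx.1, Real.rpow_two]
    refine adjoint_ne_closure_of_wronskian hdom hact (W := 2 * ν)
      (hp (1 / 2 + ν)) (hp' _ (by ring)) (hpi _ (by linarith))
      (hp (1 / 2 - ν)) (hp' _ (by ring)) (hpi _ (by linarith)) (fun x hx => ?_) (by simpa)
    have h : x ^ (1 / 2 + ν) * x ^ (1 / 2 - ν) = x := by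
      rw [← Real.rpow_add hx]; norm_num
    rw [Real.rpow_sub_one hx.ne', Real.rpow_sub_one hx.ne']
    generalize x ^ (1 / 2 + ν) = A, x ^ (1 / 2 - ν) = B at h ⊢
    field_simp
    linear_combination (4 * ν) * h

end Operator

/-- For `ν ∈ ℝ`, the operator `l_ν = d²/dr² − (ν² − 1/4)/r²` with
domain `C_c^∞(ℝ₊)` in `L²(ℝ₊, dr)` is essentially selfadjoint iff `|ν| ≥ 1`. -/
theorem stmt18 (ν : ℝ) (T : Lp ℂ 2 halfLineMeasure →ₗ.[ℂ] Lp ℂ 2 halfLineMeasure)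
    (hdom : ∀ F : Lp ℂ 2 halfLineMeasure,
      F ∈ T.domain ↔ ∃ f, IsHalfLineTest f ∧ ⇑F =ᵐ[halfLineMeasure] f)
    (hact : ∀ (w : T.domain) (f : ℝ → ℂ), IsHalfLineTest f →
      ⇑(w : Lp ℂ 2 halfLineMeasure) =ᵐ[halfLineMeasure] f →
      ⇑(T w) =ᵐ[halfLineMeasure] besselOp ν f) :
    T.adjoint = T.closure ↔ 1 ≤ |ν| := by
  refine ⟨fun h => ?_, fun hν => adjoint_eq_closure_of_one_le_abs hν hdom hact⟩
  by_contra! hν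
  exact adjoint_ne_closure_of_abs_lt_one hν hdom hact h
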